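/- Let ψ be a flow on a metric space (X,d) such that ψ_t is Lipschitz continuous for every t ≥ 0, uniformly for t in compact subsets of [0,+∞). Then SCR(ψ) = ⋂_h N(h), where the intersection is taken over all Lipschitz continuous Lyapunov functions h for ψ. -/

import Mathlib

/-- A (continuous) flow on a metric space. -/
def IsFlow {X : Type*} [MetricSpace X] (ψ : ℝ → X → X) : Prop :=
  Continuous (fun p : ℝ × X => ψ p.1 p.2) ∧ (∀ x, ψ 0 x = x) ∧
    ∀ t s x, ψ (t + s) x = ψ t (ψ s x)

/-- There is a strong `(ε,T)`-chain from `a` to `b`: a finite sequence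
`(x_i, t_i)`, `i = 1, …, n` with `t_i ≥ T`, `x_1 = a`, `x_{n+1} = b`, and
`∑ d(ψ_{t_i}(x_i), x_{i+1}) < ε`. -/
def HasStrongChain {X : Type*} [MetricSpace X] (ψ : ℝ → X → X) (ε T : ℝ) (a b : X) : Prop :=
  ∃ (n : ℕ) (x : Fin (n + 1) → X) (t : Fin n → ℝ), 0 < n ∧ (∀ i, T ≤ t i) ∧
    x 0 = a ∧ x (Fin.last n) = b ∧
    (∑ i : Fin n, dist (ψ (t i) (x i.castSucc)) (x i.succ)) < ε

/-- A strongly chain recurrent point. -/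
def StronglyChainRecurrentPt {X : Type*} [MetricSpace X] (ψ : ℝ → X → X) (x : X) : Prop :=
  ∀ ε > 0, ∀ T ≥ (0 : ℝ), HasStrongChain ψ ε T x x

/-- A Lyapunov function for the flow `ψ`. -/
def IsLyapunov {X : Type*} [MetricSpace X] (ψ : ℝ → X → X) (h : X → ℝ) : Prop :=
  ∀ t ≥ (0 : ℝ), ∀ x, h (ψ t x) ≤ h x

/-- The neutral set of a Lyapunov function. -/
def NeutralSet {X : Type*} [MetricSpace X] (ψ : ℝ → X → X) (h : X → ℝ) : Set X :=
  {x | ∀ t : ℝ, h (ψ t x) = h x}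

/-- A first integral for the flow `ψ`. -/
def IsFirstIntegral {X : Type*} [MetricSpace X] (ψ : ℝ → X → X) (h : X → ℝ) : Prop :=
  ∀ (t : ℝ) (x : X), h (ψ t x) = h x

/-- `ψ_t` is Lipschitz for every `t ≥ 0`, uniformly for `t` in compact subsets
of `[0, +∞)`. -/
def UniformlyLipschitzTimeMaps {X : Type*} [MetricSpace X] (ψ : ℝ → X → X) : Prop :=
  ∀ T ≥ (0 : ℝ), ∃ C : NNReal, ∀ t ∈ Set.Icc 0 T, LipschitzWith C (ψ t)

/-- The flow `ψ` is strongly chain transitive. -/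
def StronglyChainTransitive {X : Type*} [MetricSpace X] (ψ : ℝ → X → X) : Prop :=
  ∀ x y : X, ∀ ε > 0, ∀ T ≥ (0 : ℝ), HasStrongChain ψ ε T x y

/-- The supremum of a function along orbit segments of length `T`. -/
noncomputable def orbitSup {X : Type*} (ψ : ℝ → X → X) (T : ℝ) (f : X → ℝ) (x : X) : ℝ :=
  sSup ((fun s => f (ψ s x)) '' Set.Icc 0 T)

theorem orbitSup_le {X : Type*} {ψ : ℝ → X → X} {T : ℝ} {f : X → ℝ} (hT : 0 ≤ T) {x : X} {M : ℝ}
    (hM : ∀ s ∈ Set.Icc 0 T, f (ψ s x) ≤ M) :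
    orbitSup ψ T f x ≤ M :=
  csSup_le ((Set.nonempty_Icc.2 hT).image _) (Set.forall_mem_image.2 hM)

section StrongChains

variable {X : Type*} [MetricSpace X] {ψ : ℝ → X → X} {ε T : ℝ} {a b c : X}

theorem HasStrongChain.pos (hc : HasStrongChain ψ ε T a b) : 0 < ε := by
  obtain ⟨n, x, t, -, -, -, -, hsum⟩ := hc
  exact (Finset.sum_nonneg fun _ _ => dist_nonneg).trans_lt hsum

theorem HasStrongChain.single {t : ℝ} (ht : T ≤ t) (hd : dist (ψ t a) b < ε) :
    HasStrongChain ψ ε T a b :=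
  ⟨1, ![a, b], fun _ => t, one_pos, fun _ => ht, rfl, rfl, by simpa using hd⟩

/-- Moving the endpoint of a strong chain costs at most the displacement. -/
theorem HasStrongChain.move_end (hc : HasStrongChain ψ ε T a b) (c : X) :
    HasStrongChain ψ (ε + dist b c) T a c := by
  obtain ⟨n, x, t, hn, ht, rfl, rfl, hsum⟩ := hc
  obtain ⟨m, rfl⟩ := Nat.exists_eq_succ_of_ne_zero hn.ne'
  refine ⟨m + 1, Fin.snoc (fun i : Fin (m + 1) => x i.castSucc) c, t, hn, ht, ?_, by simp, ?_⟩
  · rw [← Fin.castSucc_zero, Fin.snoc_castSucc]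
  · rw [Fin.sum_univ_castSucc] at hsum ⊢
    simp only [Fin.succ_castSucc, Fin.snoc_castSucc, Fin.succ_last, Fin.snoc_last] at hsum ⊢
    have := dist_triangle (ψ (t (Fin.last m)) (x (Fin.last m).castSucc)) (x (Fin.last (m + 1))) c
    linarith

/-- A strong chain can be prolonged at no cost by following the flow for a long time. -/
theorem HasStrongChain.flow_end (hc : HasStrongChain ψ ε T a b) {s : ℝ} (hs : T ≤ s) :
    HasStrongChain ψ ε T a (ψ s b) := by
  obtain ⟨n, x, t, hn, ht, rfl, rfl, hsum⟩ := hc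
  refine ⟨n + 1, Fin.snoc x (ψ s (x (Fin.last n))), Fin.snoc t s, n.succ_pos, ?_, ?_, by simp, ?_⟩
  · intro i
    induction i using Fin.lastCases with
    | last => simpa using hs
    | cast i => simpa using ht i
  · rw [← Fin.castSucc_zero, Fin.snoc_castSucc]
  · rw [Fin.sum_univ_castSucc]
    simpa only [Fin.succ_castSucc, Fin.snoc_castSucc, Fin.succ_last, Fin.snoc_last, dist_self,
      add_zero] using hsum

/-- A Lipschitz Lyapunov function grows along a chain by at most its Lipschitz constant times
the total length of the jumps. -/
theorem IsLyapunov.le_add_mul_sum {h : X → ℝ} (hh : IsLyapunov ψ h) {K : NNReal}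
    (hK : LipschitzWith K h) {n : ℕ} (x : Fin (n + 1) → X) (t : Fin n → ℝ) (ht : ∀ i, 0 ≤ t i) :
    h (x (Fin.last n)) ≤
      h (x 0) + K * ∑ i : Fin n, dist (ψ (t i) (x i.castSucc)) (x i.succ) := by
  induction n with
  | zero => simp
  | succ n ih =>
    have h₁ := ih (fun i => x i.castSucc) (fun i => t i.castSucc) fun i => ht _
    have h₂ := hh _ (ht (Fin.last n)) (x (Fin.last n).castSucc)
    have h₃ := hK.le_add_mul (x (Fin.last (n + 1))) (ψ (t (Fin.last n)) (x (Fin.last n).castSucc))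
    rw [dist_comm] at h₃
    rw [Fin.sum_univ_castSucc, mul_add]
    simp only [Fin.succ_castSucc, Fin.succ_last, Fin.castSucc_zero] at h₁ ⊢
    linarith

theorem HasStrongChain.exists_last_jump {h : X → ℝ} (hc : HasStrongChain ψ ε T a b)
    (hT : 0 ≤ T) (hh : IsLyapunov ψ h) {K : NNReal} (hK : LipschitzWith K h) :
    ∃ z t, T ≤ t ∧ dist (ψ t z) b < ε ∧ h z ≤ h a + K * ε := by
  obtain ⟨n, x, t, hn, ht, rfl, rfl, hsum⟩ := hc
  obtain ⟨m, rfl⟩ := Nat.exists_eq_succ_of_ne_zero hn.ne'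
  rw [Fin.sum_univ_castSucc] at hsum
  have hnonneg : 0 ≤ ∑ i : Fin m, dist (ψ (t i.castSucc) (x i.castSucc.castSucc))
      (x i.castSucc.succ) := Finset.sum_nonneg fun _ _ => dist_nonneg
  have hlast : 0 ≤ dist (ψ (t (Fin.last m)) (x (Fin.last m).castSucc)) (x (Fin.last m).succ) :=
    dist_nonneg
  refine ⟨x (Fin.last m).castSucc, t (Fin.last m), ht _, ?_, ?_⟩
  · rw [Fin.succ_last] at hsum
    linarith
  · refine (hh.le_add_mul_sum hK (fun i => x i.castSucc) (fun i => t i.castSucc)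
      fun i => hT.trans (ht _)).trans ?_
    simp only [Fin.succ_castSucc, Fin.castSucc_zero] at hsum hnonneg ⊢
    gcongr
    linarith

theorem IsFlow.continuous_time (hψ : IsFlow ψ) (s : ℝ) : Continuous (ψ s) :=
  hψ.1.comp (Continuous.prodMk_right s)

theorem IsFlow.continuous_orbit (hψ : IsFlow ψ) (x : X) : Continuous fun s => ψ s x :=
  hψ.1.comp (Continuous.prodMk_left x)

theorem StronglyChainRecurrentPt.eq_backward (hψ : IsFlow ψ) {x : X}
    (hx : StronglyChainRecurrentPt ψ x) {h : X → ℝ} (hh : IsLyapunov ψ h) {K : NNReal}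
    (hK : LipschitzWith K h) {s : ℝ} (hs : 0 ≤ s) : h (ψ (-s) x) = h x := by
  apply le_antisymm
  · apply le_of_forall_pos_le_add
    intro η hη
    obtain ⟨δ, hδ, hcont⟩ := Metric.continuous_iff.1
      (hK.continuous.comp (hψ.continuous_time (-s))) x (η / 2) (half_pos hη)
    have hK1 : 0 < (K : ℝ) + 1 := by positivity
    obtain ⟨z, t, hst, hd, hz⟩ :=
      (hx (min δ (η / 2 / (K + 1))) (by positivity) s hs).exists_last_jump hs hh hK
    have h₁ := hcont _ (hd.trans_le (min_le_left _ _))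
    simp only [Function.comp_apply, ← hψ.2.2] at h₁
    have h₂ := hh (-s + t) (by linarith) z
    have h₃ : K * min δ (η / 2 / (K + 1)) ≤ η / 2 := by
      calc K * min δ (η / 2 / (K + 1)) ≤ (K + 1) * (η / 2 / (K + 1)) := by
            gcongr
            · exact le_add_of_nonneg_right zero_le_one
            · exact min_le_right _ _
        _ = η / 2 := mul_div_cancel₀ _ hK1.ne'
    rw [Real.dist_eq] at h₁
    linarith [(abs_lt.1 h₁).1]
  · simpa [← hψ.2.2, hψ.2.1] using hh s hs (ψ (-s) x)

theorem StronglyChainRecurrentPt.mem_neutralSet (hψ : IsFlow ψ)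
    (hLip : UniformlyLipschitzTimeMaps ψ) {x : X}
    (hx : StronglyChainRecurrentPt ψ x) {h : X → ℝ} (hh : IsLyapunov ψ h) {K : NNReal}
    (hK : LipschitzWith K h) : x ∈ NeutralSet ψ h := by
  intro t
  rcases le_total t 0 with ht | ht
  · simpa using hx.eq_backward hψ hh hK (neg_nonneg.2 ht)
  · obtain ⟨C, hC⟩ := hLip t ht
    have hlyap : IsLyapunov ψ fun y => h (ψ t y) := by
      intro s hs y
      simpa only [← hψ.2.2, add_comm t s] using hh s hs (ψ t y)
    have := hx.eq_backward hψ hlyap (hK.comp (hC t ⟨ht, le_rfl⟩)) ht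
    simpa [← hψ.2.2, hψ.2.1] using this.symm

/-- The infimal total jump length of the chains from `a` to `b` with times at least `T`. -/
noncomputable def strongChainCost (ψ : ℝ → X → X) (T : ℝ) (a b : X) : ℝ :=
  sInf {ε | HasStrongChain ψ ε T a b}

theorem bddBelow_setOf_hasStrongChain : BddBelow {ε | HasStrongChain ψ ε T a b} :=
  ⟨0, fun _ h => h.pos.le⟩

theorem nonempty_setOf_hasStrongChain : {ε | HasStrongChain ψ ε T a b}.Nonempty :=
  ⟨_, .single le_rfl (lt_add_one _)⟩

theorem strongChainCost_nonneg : 0 ≤ strongChainCost ψ T a b :=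
  le_csInf nonempty_setOf_hasStrongChain fun _ h => h.pos.le

theorem lipschitzWith_strongChainCost : LipschitzWith 1 (strongChainCost ψ T a) := by
  refine LipschitzWith.of_le_add fun b c => ?_
  rw [← sub_le_iff_le_add]
  refine le_csInf nonempty_setOf_hasStrongChain fun ε hε => ?_
  rw [sub_le_iff_le_add, dist_comm]
  exact csInf_le bddBelow_setOf_hasStrongChain (hε.move_end b)

theorem strongChainCost_flow_le {s : ℝ} (hs : T ≤ s) :
    strongChainCost ψ T a (ψ s b) ≤ strongChainCost ψ T a b :=
  csInf_le_csInf bddBelow_setOf_hasStrongChain nonempty_setOf_hasStrongChain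
    fun _ hε => hε.flow_end hs

theorem strongChainCost_flow_self {s : ℝ} (hs : T ≤ s) : strongChainCost ψ T a (ψ s a) = 0 := by
  refine le_antisymm (le_of_forall_pos_le_add fun ε hε => ?_) strongChainCost_nonneg
  rw [zero_add]
  exact csInf_le bddBelow_setOf_hasStrongChain (.single hs (by simpa using hε))

theorem le_strongChainCost (h : ¬ HasStrongChain ψ ε T a b) : ε ≤ strongChainCost ψ T a b := by
  refine le_csInf nonempty_setOf_hasStrongChain fun δ hδ => ?_
  contrapose! h
  obtain ⟨n, x, t, hn, ht, ha, hb, hsum⟩ := hδ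
  exact ⟨n, x, t, hn, ht, ha, hb, hsum.trans h⟩

section OrbitSup

variable {f : X → ℝ}

theorem le_orbitSup (hψ : IsFlow ψ) (hf : Continuous f) (x : X) {s : ℝ}
    (hs : s ∈ Set.Icc 0 T) : f (ψ s x) ≤ orbitSup ψ T f x :=
  le_csSup (isCompact_Icc.bddAbove_image (hf.comp (hψ.continuous_orbit x)).continuousOn)
    (Set.mem_image_of_mem _ hs)

theorem lipschitzWith_orbitSup (hψ : IsFlow ψ) (hT : 0 ≤ T) {K C : NNReal}
    (hf : LipschitzWith K f) (hC : ∀ t ∈ Set.Icc 0 T, LipschitzWith C (ψ t)) :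
    LipschitzWith (K * C) (orbitSup ψ T f) := by
  refine LipschitzWith.of_le_add_mul _ fun x y => orbitSup_le hT fun s hs => ?_
  exact ((hf.comp (hC s hs)).le_add_mul x y).trans
    (add_le_add_left (le_orbitSup hψ hf.continuous y hs) _)

theorem isLyapunov_orbitSup (hψ : IsFlow ψ) (hT : 0 ≤ T) (hf : Continuous f)
    (hdec : ∀ s, T ≤ s → ∀ x, f (ψ s x) ≤ f x) : IsLyapunov ψ (orbitSup ψ T f) := by
  refine fun s hs x => orbitSup_le hT fun r hr => ?_
  rw [← hψ.2.2]
  rcases le_total (r + s) T with h | h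
  · exact le_orbitSup hψ hf x ⟨add_nonneg hr.1 hs, h⟩
  · refine (hdec _ h x).trans ?_
    simpa only [hψ.2.1] using le_orbitSup hψ hf x (Set.left_mem_Icc.2 hT)

end OrbitSup

theorem exists_lyapunov_of_not_stronglyChainRecurrentPt (hψ : IsFlow ψ)
    (hLip : UniformlyLipschitzTimeMaps ψ) {x : X} (hx : ¬ StronglyChainRecurrentPt ψ x) :
    ∃ h : X → ℝ, (∃ K : NNReal, LipschitzWith K h) ∧ IsLyapunov ψ h ∧ x ∉ NeutralSet ψ h := by
  simp only [StronglyChainRecurrentPt, not_forall] at hx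
  obtain ⟨ε, hε, T, hT, hchain⟩ := hx
  obtain ⟨C, hC⟩ := hLip T hT
  have hf : LipschitzWith 1 (strongChainCost ψ T x) := lipschitzWith_strongChainCost
  refine ⟨orbitSup ψ T (strongChainCost ψ T x), ⟨_, lipschitzWith_orbitSup hψ hT hf hC⟩,
    isLyapunov_orbitSup hψ hT hf.continuous fun s hs _ => strongChainCost_flow_le hs,
    fun hN => ?_⟩
  have h₁ : orbitSup ψ T (strongChainCost ψ T x) (ψ T x) ≤ 0 := by
    refine orbitSup_le hT fun r hr => ?_
    rw [← hψ.2.2]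
    exact (strongChainCost_flow_self (le_add_of_nonneg_left hr.1)).le
  have h₂ := le_orbitSup hψ hf.continuous x (Set.left_mem_Icc.2 hT)
  rw [hψ.2.1] at h₂
  have h₃ := le_strongChainCost hchain
  linarith [hN T]

end StrongChains

theorem SCR_eq_iInter_neutral_sets {X : Type*} [MetricSpace X]
    (ψ : ℝ → X → X) (hψ : IsFlow ψ) (hLipFlow : UniformlyLipschitzTimeMaps ψ) :
    {x | StronglyChainRecurrentPt ψ x} =
      ⋂ h ∈ {h : X → ℝ | (∃ K : NNReal, LipschitzWith K h) ∧ IsLyapunov ψ h},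
        NeutralSet ψ h := by
  ext x
  simp only [Set.mem_iInter, Set.mem_ofPred_eq]
  constructor
  · rintro hx h ⟨⟨K, hK⟩, hh⟩
    exact hx.mem_neutralSet hψ hLipFlow hh hK
  · intro hx
    by_contra hrec
    obtain ⟨h, hK, hh, hN⟩ := exists_lyapunov_of_not_stronglyChainRecurrentPt hψ hLipFlow hrec
    exact hN (hx h ⟨hK, hh⟩)
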